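/- Let Q be an empty rectangle of arbitrary orientation contained in R whose area is maximum among all empty rectangles of arbitrary orientation contained in R. Then each of the four sides of Q either contains a point of P or intersects the boundary of R. -/

import Mathlib

open Set

/-- The rigid motion of the plane given by rotation through angle `θ`
followed by translation by `t`. -/
noncomputable def rigid (θ : ℝ) (t : ℝ × ℝ) (p : ℝ × ℝ) : ℝ × ℝ :=
  (Real.cos θ * p.1 - Real.sin θ * p.2 + t.1,
   Real.sin θ * p.1 + Real.cos θ * p.2 + t.2)

/-- The rectangle of arbitrary orientation obtained as the image of the
axis-parallel rectangle `[0,w] × [0,h]` under the rigid motion `rigid θ t`. -/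
noncomputable def orientedRect (θ : ℝ) (t : ℝ × ℝ) (w h : ℝ) : Set (ℝ × ℝ) :=
  rigid θ t '' (Icc 0 w ×ˢ Icc 0 h)

/-- The four sides of the oriented rectangle `orientedRect θ t w h`:
images of the four sides of `[0,w] × [0,h]` under the rigid motion. -/
noncomputable def orientedRectSide (θ : ℝ) (t : ℝ × ℝ) (w h : ℝ) : Fin 4 → Set (ℝ × ℝ) :=
  ![rigid θ t '' ({0} ×ˢ Icc 0 h),
    rigid θ t '' ({w} ×ˢ Icc 0 h),
    rigid θ t '' (Icc 0 w ×ˢ {(0 : ℝ)}),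
    rigid θ t '' (Icc 0 w ×ˢ {h})]

/-- `orientedRect θ t w h` (with `w, h > 0`) is an empty rectangle of
arbitrary orientation w.r.t. the region `R = [x₀,x₁] × [y₀,y₁]` and the
point set `P`: it is contained in `R` and its interior contains no point
of `P`. -/
def IsEmptyOrientedRect (P : Finset (ℝ × ℝ)) (x₀ x₁ y₀ y₁ : ℝ)
    (θ : ℝ) (t : ℝ × ℝ) (w h : ℝ) : Prop :=
  0 < w ∧ 0 < h ∧
  orientedRect θ t w h ⊆ Icc x₀ x₁ ×ˢ Icc y₀ y₁ ∧
  ∀ p ∈ P, (p : ℝ × ℝ) ∉ interior (orientedRect θ t w h)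

/-- `rigid` as a homeomorphism. -/
noncomputable def rigidHomeo (θ : ℝ) (t : ℝ × ℝ) : (ℝ × ℝ) ≃ₜ (ℝ × ℝ) where
  toFun := rigid θ t
  invFun q := (Real.cos θ * (q.1 - t.1) + Real.sin θ * (q.2 - t.2),
    - Real.sin θ * (q.1 - t.1) + Real.cos θ * (q.2 - t.2))
  left_inv p := by
    have := Real.sin_sq_add_cos_sq θ
    ext
    · simp only [rigid]; linear_combination p.1 * this
    · simp only [rigid]; linear_combination p.2 * this
  right_inv p := by
    have := Real.sin_sq_add_cos_sq θ
    ext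
    · simp only [rigid]; linear_combination (p.1 - t.1) * this
    · simp only [rigid]; linear_combination (p.2 - t.2) * this
  continuous_toFun := by unfold rigid; fun_prop
  continuous_invFun := by fun_prop

lemma interior_orientedRect (θ : ℝ) (t : ℝ × ℝ) (w h : ℝ) :
    interior (orientedRect θ t w h) = rigid θ t '' (Ioo 0 w ×ˢ Ioo 0 h) := by
  have := (rigidHomeo θ t).image_interior (Icc 0 w ×ˢ Icc 0 h)
  rw [interior_prod_eq, interior_Icc, interior_Icc] at this
  exact this.symm

lemma rigid_shift (θ : ℝ) (t c q : ℝ × ℝ) :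
    rigid θ (rigid θ t c) q = rigid θ t (c.1 + q.1, c.2 + q.2) := by
  simp only [rigid]
  ext <;> simp only <;> ring

/-- Any empty box in the local coordinates has area at most the maximum. -/
lemma local_area_le {x₀ x₁ y₀ y₁ : ℝ} {P : Finset (ℝ × ℝ)} {θ : ℝ} {t : ℝ × ℝ} {w h : ℝ}
    (hmax : ∀ θ' t' w' h', IsEmptyOrientedRect P x₀ x₁ y₀ y₁ θ' t' w' h' →
      w' * h' ≤ w * h) (a b w' h' : ℝ) (hw : 0 < w') (hh : 0 < h')
    (hR : ∀ u v, a ≤ u → u ≤ a + w' → b ≤ v → v ≤ b + h' →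
      rigid θ t (u, v) ∈ Icc x₀ x₁ ×ˢ Icc y₀ y₁)
    (hE : ∀ u v, a < u → u < a + w' → b < v → v < b + h' → rigid θ t (u, v) ∉ P) :
    w' * h' ≤ w * h := by
  apply hmax θ (rigid θ t (a, b)) w' h'
  refine ⟨hw, hh, ?_, ?_⟩
  · rintro _ ⟨⟨u, v⟩, ⟨⟨h1, h2⟩, ⟨h3, h4⟩⟩, rfl⟩
    rw [rigid_shift]
    simp only at h1 h2 h3 h4
    exact hR _ _ (by simp only; linarith) (by simp only; linarith) (by simp only; linarith)
      (by simp only; linarith)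
  · intro p hp hpi
    rw [interior_orientedRect] at hpi
    obtain ⟨⟨u, v⟩, ⟨⟨h1, h2⟩, ⟨h3, h4⟩⟩, rfl⟩ := hpi
    rw [rigid_shift] at hp
    simp only at h1 h2 h3 h4
    exact hE _ _ (by simp only; linarith) (by simp only; linarith) (by simp only; linarith)
      (by simp only; linarith) hp

/-- A free compact side has a free neighbourhood. -/
lemma side_room {x₀ x₁ y₀ y₁ : ℝ} {P : Finset (ℝ × ℝ)} {θ : ℝ} {t : ℝ × ℝ}
    {S : Set (ℝ × ℝ)} (hS : IsCompact S)
    (hSR : rigid θ t '' S ⊆ Icc x₀ x₁ ×ˢ Icc y₀ y₁)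
    (hf : ¬ ((∃ p ∈ P, (p : ℝ × ℝ) ∈ rigid θ t '' S) ∨
      (rigid θ t '' S ∩ frontier (Icc x₀ x₁ ×ˢ Icc y₀ y₁)).Nonempty)) :
    ∃ ε > 0, ∀ u v a b : ℝ, (a, b) ∈ S → |u - a| ≤ ε → |v - b| ≤ ε →
      rigid θ t (u, v) ∈ Icc x₀ x₁ ×ˢ Icc y₀ y₁ ∧ rigid θ t (u, v) ∉ P := by
  push Not at hf
  obtain ⟨hf1, hf2⟩ := hf
  have hU : IsOpen (rigid θ t ⁻¹' (interior (Icc x₀ x₁ ×ˢ Icc y₀ y₁) ∩ (P : Set (ℝ × ℝ))ᶜ)) :=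
    (isOpen_interior.inter P.finite_toSet.isClosed.isOpen_compl).preimage
      (rigidHomeo θ t).continuous
  have hSU : S ⊆ rigid θ t ⁻¹' (interior (Icc x₀ x₁ ×ˢ Icc y₀ y₁) ∩ (P : Set (ℝ × ℝ))ᶜ) := by
    intro q hq
    have hq' : rigid θ t q ∈ rigid θ t '' S := mem_image_of_mem _ hq
    refine ⟨?_, fun hp => hf1 _ hp hq'⟩
    by_contra hni
    have : rigid θ t q ∈ rigid θ t '' S ∩ frontier (Icc x₀ x₁ ×ˢ Icc y₀ y₁) :=
      ⟨hq', subset_closure (hSR hq'), hni⟩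
    rw [hf2] at this
    exact this
  obtain ⟨ε, hε, hsub⟩ := hS.exists_cthickening_subset_open hU hSU
  refine ⟨ε, hε, fun u v a b hab h1 h2 => ?_⟩
  have hd : dist (u, v) (a, b) ≤ ε := by
    rw [Prod.dist_eq, Real.dist_eq, Real.dist_eq]
    exact max_le h1 h2
  have := hsub (Metric.mem_cthickening_of_dist_le _ _ _ _ hab hd)
  exact ⟨interior_subset this.1, this.2⟩

theorem max_area_oriented_rect_sides_supported
    (x₀ x₁ y₀ y₁ : ℝ) (hx : x₀ < x₁) (hy : y₀ < y₁)
    (P : Finset (ℝ × ℝ))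
    (hP : ∀ p ∈ P, (p : ℝ × ℝ) ∈ Icc x₀ x₁ ×ˢ Icc y₀ y₁)
    (θ : ℝ) (t : ℝ × ℝ) (w h : ℝ)
    (hQ : IsEmptyOrientedRect P x₀ x₁ y₀ y₁ θ t w h)
    (hmax : ∀ θ' t' w' h', IsEmptyOrientedRect P x₀ x₁ y₀ y₁ θ' t' w' h' →
      w' * h' ≤ w * h) :
    ∀ k : Fin 4, (∃ p ∈ P, (p : ℝ × ℝ) ∈ orientedRectSide θ t w h k) ∨
      (orientedRectSide θ t w h k ∩
        frontier (Icc x₀ x₁ ×ˢ Icc y₀ y₁)).Nonempty := by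
  obtain ⟨hw, hh, hsub, hemp⟩ := hQ
  have hsub' := hsub
  unfold orientedRect at hsub
  have hbase : ∀ u v, 0 ≤ u → u ≤ w → 0 ≤ v → v ≤ h →
      rigid θ t (u, v) ∈ Icc x₀ x₁ ×ˢ Icc y₀ y₁ := fun u v h1 h2 h3 h4 =>
    hsub (mem_image_of_mem _ ⟨⟨h1, h2⟩, ⟨h3, h4⟩⟩)
  have hopen : ∀ u v, 0 < u → u < w → 0 < v → v < h → rigid θ t (u, v) ∉ P := by
    intro u v h1 h2 h3 h4 hp
    apply hemp _ hp
    rw [interior_orientedRect]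
    exact mem_image_of_mem _ ⟨⟨h1, h2⟩, ⟨h3, h4⟩⟩
  intro k
  fin_cases k
  · change (∃ p ∈ P, (p : ℝ × ℝ) ∈ rigid θ t '' ({(0 : ℝ)} ×ˢ Icc 0 h)) ∨
      (rigid θ t '' ({(0 : ℝ)} ×ˢ Icc 0 h) ∩ frontier (Icc x₀ x₁ ×ˢ Icc y₀ y₁)).Nonempty
    by_contra hf
    obtain ⟨ε, hε, hroom⟩ := side_room
      (by first | exact isCompact_singleton.prod isCompact_Icc
                | exact isCompact_Icc.prod isCompact_singleton)
      ((image_mono (prod_mono (by simp [hw.le, hh.le]) subset_rfl)).trans hsub) hf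
    have key := local_area_le hmax (-ε) (0) (w + ε) (h) (by linarith) (by linarith)
      (fun u v h1 h2 h3 h4 => by
        by_cases hc : 0 ≤ u
        · exact hbase u v (by linarith) (by linarith) (by linarith) (by linarith)
        · rw [not_le] at hc
          exact (hroom u v 0 v (by simp only [mem_prod, mem_Icc, mem_singleton_iff]; grind)
            (by rw [abs_le]; constructor <;> linarith)
            (by rw [abs_le]; constructor <;> linarith)).1)
      (fun u v h1 h2 h3 h4 => by
        by_cases hc : 0 < u
        · exact hopen u v (by linarith) (by linarith) (by linarith) (by linarith)
        · rw [not_lt] at hc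
          exact (hroom u v 0 v (by simp only [mem_prod, mem_Icc, mem_singleton_iff]; grind)
            (by rw [abs_le]; constructor <;> linarith)
            (by rw [abs_le]; constructor <;> linarith)).2)
    nlinarith [mul_pos hε hw, mul_pos hε hh]
  · change (∃ p ∈ P, (p : ℝ × ℝ) ∈ rigid θ t '' ({w} ×ˢ Icc 0 h)) ∨
      (rigid θ t '' ({w} ×ˢ Icc 0 h) ∩ frontier (Icc x₀ x₁ ×ˢ Icc y₀ y₁)).Nonempty
    by_contra hf
    obtain ⟨ε, hε, hroom⟩ := side_room
      (by first | exact isCompact_singleton.prod isCompact_Icc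
                | exact isCompact_Icc.prod isCompact_singleton)
      ((image_mono (prod_mono (by simp [hw.le, hh.le]) subset_rfl)).trans hsub) hf
    have key := local_area_le hmax (0) (0) (w + ε) (h) (by linarith) (by linarith)
      (fun u v h1 h2 h3 h4 => by
        by_cases hc : u ≤ w
        · exact hbase u v (by linarith) (by linarith) (by linarith) (by linarith)
        · rw [not_le] at hc
          exact (hroom u v w v (by simp only [mem_prod, mem_Icc, mem_singleton_iff]; grind)
            (by rw [abs_le]; constructor <;> linarith)
            (by rw [abs_le]; constructor <;> linarith)).1)
      (fun u v h1 h2 h3 h4 => by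
        by_cases hc : u < w
        · exact hopen u v (by linarith) (by linarith) (by linarith) (by linarith)
        · rw [not_lt] at hc
          exact (hroom u v w v (by simp only [mem_prod, mem_Icc, mem_singleton_iff]; grind)
            (by rw [abs_le]; constructor <;> linarith)
            (by rw [abs_le]; constructor <;> linarith)).2)
    nlinarith [mul_pos hε hw, mul_pos hε hh]
  · change (∃ p ∈ P, (p : ℝ × ℝ) ∈ rigid θ t '' (Icc 0 w ×ˢ {(0 : ℝ)})) ∨
      (rigid θ t '' (Icc 0 w ×ˢ {(0 : ℝ)}) ∩ frontier (Icc x₀ x₁ ×ˢ Icc y₀ y₁)).Nonempty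
    by_contra hf
    obtain ⟨ε, hε, hroom⟩ := side_room
      (by first | exact isCompact_singleton.prod isCompact_Icc
                | exact isCompact_Icc.prod isCompact_singleton)
      ((image_mono (prod_mono subset_rfl (by simp [hw.le, hh.le]))).trans hsub) hf
    have key := local_area_le hmax (0) (-ε) (w) (h + ε) (by linarith) (by linarith)
      (fun u v h1 h2 h3 h4 => by
        by_cases hc : 0 ≤ v
        · exact hbase u v (by linarith) (by linarith) (by linarith) (by linarith)
        · rw [not_le] at hc
          exact (hroom u v u 0 (by simp only [mem_prod, mem_Icc, mem_singleton_iff]; grind)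
            (by rw [abs_le]; constructor <;> linarith)
            (by rw [abs_le]; constructor <;> linarith)).1)
      (fun u v h1 h2 h3 h4 => by
        by_cases hc : 0 < v
        · exact hopen u v (by linarith) (by linarith) (by linarith) (by linarith)
        · rw [not_lt] at hc
          exact (hroom u v u 0 (by simp only [mem_prod, mem_Icc, mem_singleton_iff]; grind)
            (by rw [abs_le]; constructor <;> linarith)
            (by rw [abs_le]; constructor <;> linarith)).2)
    nlinarith [mul_pos hε hw, mul_pos hε hh]
  · change (∃ p ∈ P, (p : ℝ × ℝ) ∈ rigid θ t '' (Icc 0 w ×ˢ {h})) ∨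
      (rigid θ t '' (Icc 0 w ×ˢ {h}) ∩ frontier (Icc x₀ x₁ ×ˢ Icc y₀ y₁)).Nonempty
    by_contra hf
    obtain ⟨ε, hε, hroom⟩ := side_room
      (by first | exact isCompact_singleton.prod isCompact_Icc
                | exact isCompact_Icc.prod isCompact_singleton)
      ((image_mono (prod_mono subset_rfl (by simp [hw.le, hh.le]))).trans hsub) hf
    have key := local_area_le hmax (0) (0) (w) (h + ε) (by linarith) (by linarith)
      (fun u v h1 h2 h3 h4 => by
        by_cases hc : v ≤ h
        · exact hbase u v (by linarith) (by linarith) (by linarith) (by linarith)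
        · rw [not_le] at hc
          exact (hroom u v u h (by simp only [mem_prod, mem_Icc, mem_singleton_iff]; grind)
            (by rw [abs_le]; constructor <;> linarith)
            (by rw [abs_le]; constructor <;> linarith)).1)
      (fun u v h1 h2 h3 h4 => by
        by_cases hc : v < h
        · exact hopen u v (by linarith) (by linarith) (by linarith) (by linarith)
        · rw [not_lt] at hc
          exact (hroom u v u h (by simp only [mem_prod, mem_Icc, mem_singleton_iff]; grind)
            (by rw [abs_le]; constructor <;> linarith)
            (by rw [abs_le]; constructor <;> linarith)).2)
    nlinarith [mul_pos hε hw, mul_pos hε hh]
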